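/- arXiv:1703.04424 — 2 statements merged into one kernel-verified Lean document; each statement's English description precedes it below -/
import Mathlib

section
/- Let α₁, α₂, α₃ ∈ ℂ with |Re(αᵢ)| < 1/2 for i = 1, 2, 3, and define V_t(y) as the vertical-line integral V_t(y) := (1/2π) ∫_ℝ (π² y)^{-(3+iv)} Π_{±} Π_{i=1}^{3} [ Γ( (1/2 ± it + (3+iv) − αᵢ)/2 ) / Γ( (1/2 ± it − αᵢ)/2 ) ] · e^{(3+iv)²} / (3+iv) dv. Then for every integer k ≥ 0 and every real α with 0 < α ≤ (1/3) min_{1≤i≤3} (1/2 − |Re(αᵢ)|), there exists a constant C > 0 (depending only on α₁, α₂, α₃, k, α) such that for all t ∈ ℝ and all y > 0: | y^k (d/dy)^k V_t(y) − δ_k | ≤ C ( y/(1+|t|)³ )^{α}, where δ_0 = 1 and δ_k = 0 for k ≥ 1. -/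
open Complex MeasureTheory

/-- The weight function of the approximate functional equation:
`V_t(y) = (1/2πi) ∫_{(3)} (π² y)^{-u} ∏_± ∏_{i=1}^3
  Γ((1/2 ± it + u - αᵢ)/2)/Γ((1/2 ± it - αᵢ)/2) · e^{u²} du/u`,
parametrized by `u = 3 + iv`, `v ∈ ℝ`. -/
noncomputable def Vweight (α₁ α₂ α₃ : ℂ) (t : ℝ) (y : ℝ) : ℂ :=
  (1 / (2 * Real.pi)) * ∫ v : ℝ,
    ((Real.pi ^ 2 * y : ℝ) : ℂ) ^ (-(3 + Complex.I * v)) *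
      (Complex.Gamma ((1 / 2 + Complex.I * t + (3 + Complex.I * v) - α₁) / 2) /
        Complex.Gamma ((1 / 2 + Complex.I * t - α₁) / 2)) *
      (Complex.Gamma ((1 / 2 + Complex.I * t + (3 + Complex.I * v) - α₂) / 2) /
        Complex.Gamma ((1 / 2 + Complex.I * t - α₂) / 2)) *
      (Complex.Gamma ((1 / 2 + Complex.I * t + (3 + Complex.I * v) - α₃) / 2) /
        Complex.Gamma ((1 / 2 + Complex.I * t - α₃) / 2)) *
      (Complex.Gamma ((1 / 2 - Complex.I * t + (3 + Complex.I * v) - α₁) / 2) /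
        Complex.Gamma ((1 / 2 - Complex.I * t - α₁) / 2)) *
      (Complex.Gamma ((1 / 2 - Complex.I * t + (3 + Complex.I * v) - α₂) / 2) /
        Complex.Gamma ((1 / 2 - Complex.I * t - α₂) / 2)) *
      (Complex.Gamma ((1 / 2 - Complex.I * t + (3 + Complex.I * v) - α₃) / 2) /
        Complex.Gamma ((1 / 2 - Complex.I * t - α₃) / 2)) *
      Complex.exp ((3 + Complex.I * v) ^ 2) / (3 + Complex.I * v)

lemma one_add_sq_div_sq_interp {X b : ℝ} (y : ℝ) (hX : 0 < X) (hb : 0 ≤ b) (hb1 : b ≤ 1) :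
    1 + y ^ 2 / (X + b) ^ 2 ≤
      (1 + y ^ 2 / X ^ 2) ^ (1 - b) * (1 + y ^ 2 / (X + 1) ^ 2) ^ b := by
  set p := y ^ 2 / X ^ 2 with hp
  set q := y ^ 2 / (X + 1) ^ 2 with hq
  have hp0 : 0 ≤ p := by positivity
  have hq0 : 0 ≤ q := by positivity
  have hb' : 0 ≤ 1 - b := by linarith
  have h1 : (1 + p)⁻¹ ^ (1 - b) * (1 + q)⁻¹ ^ b ≤ (1 - b) * (1 + p)⁻¹ + b * (1 + q)⁻¹ :=
    Real.geom_mean_le_arith_mean2_weighted hb' hb (by positivity) (by positivity) (by ring)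
  have h2 : (p * (1 + p)⁻¹) ^ (1 - b) * (q * (1 + q)⁻¹) ^ b ≤
      (1 - b) * (p * (1 + p)⁻¹) + b * (q * (1 + q)⁻¹) :=
    Real.geom_mean_le_arith_mean2_weighted hb' hb (by positivity) (by positivity) (by ring)
  rw [Real.mul_rpow hp0 (by positivity), Real.mul_rpow hq0 (by positivity)] at h2
  have h3 : X ^ (1 - b) * (X + 1) ^ b ≤ X + b :=
    (Real.geom_mean_le_arith_mean2_weighted hb' hb hX.le (by positivity) (by ring)).trans
      (by linarith)
  have h4 : y ^ 2 / (X + b) ^ 2 ≤ p ^ (1 - b) * q ^ b := by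
    have e : p ^ (1 - b) * q ^ b = y ^ 2 / (X ^ (1 - b) * (X + 1) ^ b) ^ 2 := by
      rw [hp, hq, Real.div_rpow (by positivity) (by positivity),
        Real.div_rpow (by positivity) (by positivity), div_mul_div_comm,
        mul_pow, ← Real.rpow_natCast (X ^ (1 - b)), ← Real.rpow_natCast ((X + 1) ^ b),
        ← Real.rpow_natCast X, ← Real.rpow_natCast (X + 1),
        ← Real.rpow_mul hX.le, ← Real.rpow_mul hX.le, ← Real.rpow_mul (by positivity),
        ← Real.rpow_mul (by positivity), mul_comm (1 - b), mul_comm b]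
      congr 1
      rw [← Real.rpow_add_of_nonneg (by positivity) hb' hb]
      simp
    rw [e]
    gcongr
  have h5 : (1 + p) ^ (1 - b) * (1 + p)⁻¹ ^ (1 - b) = 1 := by
    rw [← Real.mul_rpow (by positivity) (by positivity), mul_inv_cancel₀ (by positivity),
      Real.one_rpow]
  have h6 : (1 + q) ^ b * (1 + q)⁻¹ ^ b = 1 := by
    rw [← Real.mul_rpow (by positivity) (by positivity), mul_inv_cancel₀ (by positivity),
      Real.one_rpow]
  have hs : (1 + p)⁻¹ ^ (1 - b) * (1 + q)⁻¹ ^ b * (1 + p ^ (1 - b) * q ^ b) ≤ 1 := by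
    have e1 : (1 + p)⁻¹ + p * (1 + p)⁻¹ = 1 := by field_simp
    have e2 : (1 + q)⁻¹ + q * (1 + q)⁻¹ = 1 := by field_simp
    have : (1 - b) * ((1 + p)⁻¹ + p * (1 + p)⁻¹) + b * ((1 + q)⁻¹ + q * (1 + q)⁻¹) = 1 := by
      rw [e1, e2]; ring
    nlinarith
  calc 1 + y ^ 2 / (X + b) ^ 2 ≤ 1 + p ^ (1 - b) * q ^ b := by linarith
    _ = ((1 + p) ^ (1 - b) * (1 + p)⁻¹ ^ (1 - b)) * ((1 + q) ^ b * (1 + q)⁻¹ ^ b) *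
        (1 + p ^ (1 - b) * q ^ b) := by rw [h5, h6]; ring
    _ = (1 + p) ^ (1 - b) * (1 + q) ^ b *
        ((1 + p)⁻¹ ^ (1 - b) * (1 + q)⁻¹ ^ b * (1 + p ^ (1 - b) * q ^ b)) := by ring
    _ ≤ (1 + p) ^ (1 - b) * (1 + q) ^ b * 1 := by gcongr
    _ = _ := mul_one _

lemma tendsto_prod_one_add_sq_div_sq {x : ℝ} (hx : 0 < x) (y : ℝ) :
    Filter.Tendsto (fun n : ℕ ↦ ∏ j ∈ Finset.range (n + 1), (1 + y ^ 2 / (x + j) ^ 2))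
      Filter.atTop (nhds ((Real.Gamma x / ‖Gamma (x + y * I)‖) ^ 2)) := by
  have hne : Gamma (x + y * I) ≠ 0 := Gamma_ne_zero_of_re_pos (by simpa using hx)
  have h := (((GammaSeq_tendsto_Gamma (x : ℂ)).div
    (GammaSeq_tendsto_Gamma (x + y * I)) hne).norm.pow 2)
  rw [norm_div, Gamma_ofReal, norm_real, Real.norm_of_nonneg (Real.Gamma_pos_of_pos hx).le] at h
  refine h.congr' ?_
  filter_upwards [Filter.eventually_gt_atTop 0] with n hn
  have hn' : (0 : ℝ) < n := by exact_mod_cast hn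
  have hc (z : ℂ) : ‖(n : ℂ) ^ z‖ = (n : ℝ) ^ z.re := by
    rw [← norm_cpow_eq_rpow_re_of_pos hn']; simp
  simp only [Pi.div_apply, GammaSeq, norm_div, norm_mul, hc, norm_prod]
  have : ∀ j : ℕ, 0 < ‖(x : ℂ) + j‖ ∧ 0 < ‖(x : ℂ) + y * I + j‖ ∧
      1 + y ^ 2 / (x + j) ^ 2 = (‖(x : ℂ) + y * I + j‖ / ‖(x : ℂ) + j‖) ^ 2 := by
    intro j
    have hj : (0 : ℝ) < x + j := by positivity
    have e1 : ‖(x : ℂ) + j‖ = x + j := by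
      have := norm_real (x + j)
      rw [Real.norm_of_nonneg hj.le] at this
      exact_mod_cast this
    have e2 : ‖(x : ℂ) + y * I + j‖ ^ 2 = (x + j) ^ 2 + y ^ 2 := by
      rw [← normSq_eq_norm_sq, normSq_apply]; simp; ring
    refine ⟨by rw [e1]; exact hj, norm_pos_iff.2 fun h0 ↦ ?_, ?_⟩
    · rw [h0] at e2
      have : 0 < (x + j) ^ 2 := by positivity
      simp at e2
      nlinarith [sq_nonneg y]
    · rw [div_pow, e1, e2]; field_simp
  rw [Finset.prod_congr rfl fun j _ ↦ (this j).2.2, Finset.prod_pow, Finset.prod_div_distrib]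
  have p1 : ∏ j ∈ Finset.range (n + 1), ‖(x : ℂ) + j‖ ≠ 0 :=
    Finset.prod_ne_zero_iff.2 fun j _ ↦ (this j).1.ne'
  have p2 : ∏ j ∈ Finset.range (n + 1), ‖(x : ℂ) + y * I + j‖ ≠ 0 :=
    Finset.prod_ne_zero_iff.2 fun j _ ↦ (this j).2.1.ne'
  have p3 : ‖(Nat.factorial n : ℂ)‖ ≠ 0 := by
    simpa using Nat.factorial_ne_zero n
  have p4 : (n : ℝ) ^ x ≠ 0 := (Real.rpow_pos_of_pos hn' x).ne'
  have e : ((x : ℂ) + y * I).re = x := by simp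
  rw [e, ofReal_re]
  field_simp

lemma Gamma_div_norm_Gamma_interp {x b : ℝ} (hx : 0 < x) (hb : 0 ≤ b) (hb1 : b ≤ 1) (y : ℝ) :
    Real.Gamma (x + b) / ‖Gamma ((x + b : ℝ) + y * I)‖ ≤
      Real.Gamma x / ‖Gamma (x + y * I)‖ * (x / ‖(x : ℂ) + y * I‖) ^ b := by
  have hpos : ∀ {u : ℝ}, 0 < u → 0 < Real.Gamma u / ‖Gamma (u + y * I)‖ := fun {u} hu ↦
    div_pos (Real.Gamma_pos_of_pos hu)
      (norm_pos_iff.2 (Gamma_ne_zero_of_re_pos (by simpa using hu)))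
  have hxne : (x : ℂ) + y * I ≠ 0 := fun h ↦ by
    have := congrArg re h
    simp at this; linarith
  have h1 : Real.Gamma (x + 1) / ‖Gamma ((x + 1 : ℝ) + y * I)‖ =
      Real.Gamma x / ‖Gamma (x + y * I)‖ * (x / ‖(x : ℂ) + y * I‖) := by
    have : ((x + 1 : ℝ) : ℂ) + y * I = (x + y * I) + 1 := by push_cast; ring
    rw [this, Complex.Gamma_add_one _ hxne, Real.Gamma_add_one hx.ne', norm_mul]
    have := (hpos hx).ne'
    field_simp
  have h := le_of_tendsto_of_tendsto' (tendsto_prod_one_add_sq_div_sq (x := x + b) (by positivity) y)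
    (((tendsto_prod_one_add_sq_div_sq hx y).rpow_const (p := 1 - b) (Or.inr (by linarith))).mul
      ((tendsto_prod_one_add_sq_div_sq (x := x + 1) (by positivity) y).rpow_const
        (p := b) (Or.inr hb))) (fun n ↦ by
      rw [← Real.finsetProd_rpow _ _ (fun j _ ↦ by positivity),
        ← Real.finsetProd_rpow _ _ (fun j _ ↦ by positivity), ← Finset.prod_mul_distrib]
      refine Finset.prod_le_prod (fun j _ ↦ by positivity) fun j _ ↦ ?_
      have := one_add_sq_div_sq_interp (X := x + j) y (by positivity) hb hb1
      rwa [add_right_comm x b, add_right_comm x 1])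
  rw [h1] at h
  have hr := hpos hx
  set r := Real.Gamma x / ‖Gamma (x + y * I)‖
  have hm : 0 < x / ‖(x : ℂ) + y * I‖ := div_pos hx (norm_pos_iff.2 hxne)
  set m := x / ‖(x : ℂ) + y * I‖
  have e : (r ^ 2) ^ (1 - b) * ((r * m) ^ 2) ^ b = (r * m ^ b) ^ 2 := by
    rw [mul_pow r m, Real.mul_rpow (by positivity) (by positivity), ← mul_assoc,
      ← Real.rpow_add (by positivity), sub_add_cancel, Real.rpow_one, mul_pow,
      ← Real.rpow_natCast m, ← Real.rpow_mul hm.le, ← Real.rpow_natCast (m ^ b),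
      ← Real.rpow_mul hm.le, mul_comm b]
  rw [e] at h
  exact le_of_sq_le_sq h (by positivity)

lemma norm_Gamma_le_Gamma_re {s : ℂ} (hs : 0 < s.re) : ‖Gamma s‖ ≤ Real.Gamma s.re := by
  have h := ge_of_tendsto' (tendsto_prod_one_add_sq_div_sq hs s.im) (b := 1) fun n ↦ by
    refine Finset.prod_induction _ (fun r : ℝ ↦ 1 ≤ r)
      (fun _ _ ↦ one_le_mul_of_one_le_of_one_le) le_rfl fun j _ ↦ ?_
    have : 0 ≤ s.im ^ 2 / (s.re + j) ^ 2 := by positivity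
    linarith
  rw [re_add_im] at h
  have hpos : 0 < ‖Gamma s‖ := norm_pos_iff.2 (Gamma_ne_zero_of_re_pos hs)
  have h1 : 1 ≤ Real.Gamma s.re / ‖Gamma s‖ := by
    have := (Real.Gamma_pos_of_pos hs).le
    exact (one_le_sq_iff₀ (by positivity)).1 h
  rwa [one_le_div hpos] at h1

lemma norm_Gamma_half_sq (y : ℝ) :
    ‖Gamma ((1 / 2 : ℝ) + y * I)‖ ^ 2 = Real.pi / Real.cosh (Real.pi * y) := by
  have h := congrArg norm (Gamma_mul_Gamma_one_sub ((1 / 2 : ℝ) + y * I))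
  have e : 1 - (((1 / 2 : ℝ) : ℂ) + y * I) =
      (starRingEnd ℂ) (((1 / 2 : ℝ) : ℂ) + y * I) := by
    apply Complex.ext
    · simp; norm_num
    · simp
  have e2 : sin (Real.pi * (((1 / 2 : ℝ) : ℂ) + y * I)) = (Real.cosh (Real.pi * y) : ℂ) := by
    have : (Real.pi : ℂ) * (((1 / 2 : ℝ) : ℂ) + y * I) =
        ((Real.pi * y : ℝ) : ℂ) * I + Real.pi / 2 := by push_cast; ring
    rw [this, Complex.sin_add_pi_div_two, cos_mul_I, ofReal_cosh]
  rw [e, Gamma_conj, e2, norm_mul, RCLike.norm_conj, norm_div, norm_real, norm_real,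
    Real.norm_of_nonneg Real.pi_pos.le, Real.norm_of_nonneg (Real.cosh_pos _).le] at h
  rw [sq, h]

lemma Real.cosh_le_exp_mul_cosh (p q : ℝ) :
    Real.cosh p ≤ Real.exp |q - p| * Real.cosh q := by
  rw [Real.cosh_eq, Real.cosh_eq]
  have h1 : Real.exp p ≤ Real.exp |q - p| * Real.exp q := by
    rw [← Real.exp_add, Real.exp_le_exp]; linarith [neg_abs_le (q - p)]
  have h2 : Real.exp (-p) ≤ Real.exp |q - p| * Real.exp (-q) := by
    rw [← Real.exp_add, Real.exp_le_exp]; linarith [le_abs_self (q - p)]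
  linarith

lemma norm_Gamma_half_le (y y' : ℝ) :
    ‖Gamma ((1 / 2 : ℝ) + y' * I)‖ ≤
      Real.exp (2 * |y' - y|) * ‖Gamma ((1 / 2 : ℝ) + y * I)‖ := by
  refine le_of_sq_le_sq ?_ (by positivity)
  rw [mul_pow, norm_Gamma_half_sq, norm_Gamma_half_sq, ← Real.exp_nat_mul, mul_div_assoc',
    div_le_div_iff₀ (Real.cosh_pos _) (Real.cosh_pos _)]
  have h := Real.cosh_le_exp_mul_cosh (Real.pi * y) (Real.pi * y')
  have h2 : Real.exp |Real.pi * y' - Real.pi * y| ≤ Real.exp ((2 : ℕ) * (2 * |y' - y|)) := by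
    rw [Real.exp_le_exp, ← mul_sub, abs_mul, abs_of_pos Real.pi_pos]
    push_cast
    nlinarith [Real.pi_le_four, abs_nonneg (y' - y)]
  have h3 : Real.cosh (Real.pi * y) ≤
      Real.exp ((2 : ℕ) * (2 * |y' - y|)) * Real.cosh (Real.pi * y') :=
    h.trans (by gcongr)
  nlinarith [Real.pi_pos]

lemma div_norm_le_two_div {x : ℝ} (hx : 0 < x) (hx1 : x ≤ 1) (y : ℝ) :
    x / ‖(x : ℂ) + y * I‖ ≤ 2 / (1 + |y|) := by
  have h1 : x ≤ ‖(x : ℂ) + y * I‖ := by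
    simpa using (le_abs_self _).trans (abs_re_le_norm ((x : ℂ) + y * I))
  have h2 : |y| ≤ ‖(x : ℂ) + y * I‖ := by
    simpa using abs_im_le_norm ((x : ℂ) + y * I)
  rw [div_le_div_iff₀ (by linarith) (by positivity)]
  nlinarith [abs_nonneg y]

lemma exists_norm_Gamma_le_half {x : ℝ} (hx : 0 < x) (hx2 : x ≤ 1 / 2) :
    ∃ C : ℝ, 0 < C ∧ ∀ y : ℝ, ‖Gamma (x + y * I)‖ ≤
      C * (1 + |y|) ^ (x - 1 / 2) * ‖Gamma ((1 / 2 : ℝ) + y * I)‖ := by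
  refine ⟨Real.Gamma x / Real.Gamma (1 / 2) * 2 ^ (1 / 2 - x), ?_, fun y ↦ ?_⟩
  · have := Real.Gamma_pos_of_pos hx
    have := Real.Gamma_pos_of_pos (one_half_pos (α := ℝ))
    positivity
  have hG := Real.Gamma_pos_of_pos hx
  have hH := Real.Gamma_pos_of_pos (one_half_pos (α := ℝ))
  have h := Gamma_div_norm_Gamma_interp (b := 1 / 2 - x) hx (by linarith) (by linarith) y
  rw [add_sub_cancel] at h
  have p1 : 0 < ‖Gamma (x + y * I)‖ := norm_pos_iff.2 (Gamma_ne_zero_of_re_pos (by simpa using hx))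
  have p2 : 0 < ‖Gamma ((1 / 2 : ℝ) + y * I)‖ :=
    norm_pos_iff.2 (Gamma_ne_zero_of_re_pos (by simp))
  have h3 : (x / ‖(x : ℂ) + y * I‖) ^ (1 / 2 - x) ≤ 2 ^ (1 / 2 - x) * (1 + |y|) ^ (x - 1 / 2) := by
    calc _ ≤ (2 / (1 + |y|)) ^ (1 / 2 - x) :=
          Real.rpow_le_rpow (by positivity) (div_norm_le_two_div hx (by linarith) y) (by linarith)
      _ = _ := by
          rw [Real.div_rpow (by norm_num) (by positivity), div_eq_mul_inv,
            ← Real.rpow_neg (by positivity), neg_sub]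
  have h4 := h.trans (mul_le_mul_of_nonneg_left h3 (by positivity))
  rw [div_mul_eq_mul_div, div_le_div_iff₀ p2 p1] at h4
  calc ‖Gamma (x + y * I)‖
      = Real.Gamma (1 / 2) * ‖Gamma (x + y * I)‖ / Real.Gamma (1 / 2) := by field_simp
    _ ≤ _ := div_le_div_of_nonneg_right h4 hH.le
    _ = _ := by ring

lemma exists_norm_Gamma_half_le {x : ℝ} (hx : 0 < x) (hx2 : x ≤ 1 / 2) :
    ∃ C : ℝ, 0 < C ∧ ∀ y : ℝ, ‖Gamma ((1 / 2 : ℝ) + y * I)‖ ≤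
      C * (1 + |y|) ^ (1 / 2 - x) * ‖Gamma (x + y * I)‖ := by
  refine ⟨Real.Gamma (1 / 2) / Real.Gamma (x + 1) * 2 ^ (x + 1 / 2), ?_, fun y ↦ ?_⟩
  · have := Real.Gamma_pos_of_pos (show 0 < x + 1 by linarith)
    have := Real.Gamma_pos_of_pos (one_half_pos (α := ℝ))
    positivity
  have hG := Real.Gamma_pos_of_pos (show 0 < x + 1 by linarith)
  have hH := Real.Gamma_pos_of_pos (one_half_pos (α := ℝ))
  have h := Gamma_div_norm_Gamma_interp (x := 1 / 2) (b := x + 1 / 2) (by norm_num) (by linarith)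
    (by linarith) y
  have hxne : (x : ℂ) + y * I ≠ 0 := fun h ↦ by
    have := congrArg re h
    simp at this; linarith
  have e1 : (((1 / 2 + (x + 1 / 2) : ℝ) : ℂ) + y * I) = (x + y * I) + 1 := by push_cast; ring
  have e2 : (1 / 2 + (x + 1 / 2) : ℝ) = x + 1 := by ring
  rw [e1, e2, Complex.Gamma_add_one _ hxne, norm_mul] at h
  have p0 : 0 < ‖(x : ℂ) + y * I‖ := norm_pos_iff.2 hxne
  have p1 : 0 < ‖Gamma (x + y * I)‖ := norm_pos_iff.2 (Gamma_ne_zero_of_re_pos (by simpa using hx))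
  have p2 : 0 < ‖Gamma ((1 / 2 : ℝ) + y * I)‖ :=
    norm_pos_iff.2 (Gamma_ne_zero_of_re_pos (by simp))
  have h3 : (1 / 2 / ‖((1 / 2 : ℝ) : ℂ) + y * I‖) ^ (x + 1 / 2) ≤
      2 ^ (x + 1 / 2) * (1 + |y|) ^ (-(x + 1 / 2)) := by
    calc _ ≤ (2 / (1 + |y|)) ^ (x + 1 / 2) :=
          Real.rpow_le_rpow (by positivity)
            (div_norm_le_two_div (by norm_num) (by norm_num) y) (by linarith)
      _ = _ := by
          rw [Real.div_rpow (by norm_num) (by positivity), div_eq_mul_inv,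
            ← Real.rpow_neg (by positivity)]
  have h5 : ‖(x : ℂ) + y * I‖ ≤ 1 + |y| := by
    refine (norm_add_le _ _).trans ?_
    simp only [norm_mul, norm_real, norm_I, mul_one, Real.norm_eq_abs, abs_of_pos hx]
    linarith
  have h4 := h.trans (mul_le_mul_of_nonneg_left h3 (by positivity))
  rw [div_mul_eq_mul_div, div_le_div_iff₀ (by positivity) p2] at h4
  have e3 : (1 + |y|) ^ (1 / 2 - x) = (1 + |y|) ^ (-(x + 1 / 2)) * (1 + |y|) := by
    rw [← Real.rpow_add_one (by positivity)]; congr 1; ring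
  calc ‖Gamma ((1 / 2 : ℝ) + y * I)‖
      = Real.Gamma (x + 1) * ‖Gamma ((1 / 2 : ℝ) + y * I)‖ / Real.Gamma (x + 1) := by field_simp
    _ ≤ _ := div_le_div_of_nonneg_right h4 hG.le
    _ ≤ Real.Gamma (1 / 2) * (2 ^ (x + 1 / 2) * (1 + |y|) ^ (-(x + 1 / 2))) *
          ((1 + |y|) * ‖Gamma (x + y * I)‖) / Real.Gamma (x + 1) := by gcongr
    _ = _ := by rw [e3]; ring

/-- A Stirling-type bound: shifting the argument to the left by `b` gains a factor `|Im z| ^ (-b)`,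
up to exponential growth in the difference of the imaginary parts. -/
lemma exists_norm_Gamma_le_rpow_mul_norm_Gamma {x b : ℝ} (hb : 0 ≤ b) (hbx : b < x)
    (hx : x ≤ 1 / 2) :
    ∃ C : ℝ, 0 < C ∧ ∀ z s : ℂ, z.re = x → s.re = x - b →
      ‖Gamma s‖ ≤ C * (1 + |z.im|) ^ (-b) * Real.exp (3 * |s.im - z.im|) * ‖Gamma z‖ := by
  obtain ⟨C₁, hC₁, h₁⟩ := exists_norm_Gamma_le_half (x := x - b) (by linarith) (by linarith)
  obtain ⟨C₂, hC₂, h₂⟩ := exists_norm_Gamma_half_le (x := x) (by linarith) hx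
  refine ⟨C₁ * C₂, by positivity, fun z s hz hs ↦ ?_⟩
  have hs' : s = ((x - b : ℝ) : ℂ) + s.im * I := by rw [← hs, re_add_im]
  have hz' : z = (x : ℂ) + z.im * I := by rw [← hz, re_add_im]
  have k₁ := h₁ s.im
  have k₂ := h₂ z.im
  rw [← hs'] at k₁
  rw [← hz'] at k₂
  have k₃ := norm_Gamma_half_le z.im s.im
  set y := z.im
  set y' := s.im
  have k₄ : (1 + |y'|) ^ (x - b - 1 / 2) ≤
      Real.exp |y' - y| * (1 + |y|) ^ (x - b - 1 / 2) := by
    have hp : 0 ≤ 1 / 2 - x + b := by linarith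
    have e : x - b - 1 / 2 = -(1 / 2 - x + b) := by ring
    have l1 : 1 + |y| ≤ (1 + |y'|) * (1 + |y' - y|) := by
      have : |y| ≤ |y'| + |y' - y| := by
        rw [abs_sub_comm]; linarith [abs_sub_abs_le_abs_sub y y']
      nlinarith [abs_nonneg y', abs_nonneg (y' - y)]
    have l2 : (1 + |y|) ^ (1 / 2 - x + b) ≤ (1 + |y'|) ^ (1 / 2 - x + b) * Real.exp |y' - y| := by
      calc _ ≤ ((1 + |y'|) * (1 + |y' - y|)) ^ (1 / 2 - x + b) :=
            Real.rpow_le_rpow (by positivity) l1 hp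
        _ = (1 + |y'|) ^ (1 / 2 - x + b) * (1 + |y' - y|) ^ (1 / 2 - x + b) :=
            Real.mul_rpow (by positivity) (by positivity)
        _ ≤ _ := by
            gcongr
            calc (1 + |y' - y|) ^ (1 / 2 - x + b) ≤ (1 + |y' - y|) ^ (1 : ℝ) :=
                  Real.rpow_le_rpow_of_exponent_le (by linarith [abs_nonneg (y' - y)]) (by linarith)
              _ ≤ _ := by
                  rw [Real.rpow_one, add_comm]; exact Real.add_one_le_exp _
    rw [e, Real.rpow_neg (by positivity), Real.rpow_neg (by positivity), ← div_eq_mul_inv,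
      inv_eq_one_div, div_le_div_iff₀ (by positivity) (by positivity), one_mul]
    linarith
  calc ‖Gamma s‖ ≤ C₁ * (1 + |y'|) ^ (x - b - 1 / 2) * ‖Gamma ((1 / 2 : ℝ) + y' * I)‖ := k₁
    _ ≤ C₁ * (Real.exp |y' - y| * (1 + |y|) ^ (x - b - 1 / 2)) *
        (Real.exp (2 * |y' - y|) * (C₂ * (1 + |y|) ^ (1 / 2 - x) * ‖Gamma z‖)) := by
      refine mul_le_mul (by gcongr) (k₃.trans (by gcongr)) (by positivity) (by positivity)
    _ = C₁ * C₂ * ((1 + |y|) ^ (x - b - 1 / 2) * (1 + |y|) ^ (1 / 2 - x)) *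
        (Real.exp |y' - y| * Real.exp (2 * |y' - y|)) * ‖Gamma z‖ := by ring
    _ = _ := by
      rw [← Real.rpow_add (by positivity), ← Real.exp_add]
      congr 3
      · congr 1; ring_nf
      · ring_nf

lemma integrable_exp_mul_abs_sub_sq (M : ℝ) :
    Integrable fun v : ℝ ↦ Real.exp (M * |v| - v ^ 2) := by
  refine ((integrable_exp_neg_mul_sq (b := 1 / 2) (by norm_num)).const_mul
    (Real.exp (M ^ 2 / 2))).mono' (by fun_prop) (.of_forall fun v ↦ ?_)
  rw [Real.norm_of_nonneg (Real.exp_pos _).le, ← Real.exp_add, Real.exp_le_exp]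
  nlinarith [sq_nonneg (M - |v|), sq_abs v]

lemma norm_ofReal_cpow_sub_I_mul {y : ℝ} (hy : 0 < y) (c v : ℝ) :
    ‖(y : ℂ) ^ ((c : ℂ) - I * v)‖ = y ^ c := by
  rw [norm_cpow_eq_rpow_re_of_pos hy]; simp

lemma norm_ofReal_sub_I_mul_le (c v : ℝ) :
    ‖(c : ℂ) - I * v‖ ≤ Real.exp |c| * Real.exp |v| := by
  rw [← Real.exp_add]
  calc ‖(c : ℂ) - I * v‖ ≤ ‖(c : ℂ)‖ + ‖I * v‖ := norm_sub_le _ _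
    _ = |c| + |v| := by simp
    _ ≤ |c| + |v| + 1 := by linarith
    _ ≤ _ := Real.add_one_le_exp _

lemma continuous_ofReal_cpow_sub_I_mul {y : ℝ} (hy : 0 < y) (c : ℝ) :
    Continuous fun v : ℝ ↦ (y : ℂ) ^ ((c : ℂ) - I * v) := by
  refine Continuous.const_cpow (by fun_prop) (Or.inl ?_)
  exact_mod_cast hy.ne'

lemma integrable_cpow_mul {K : ℝ → ℂ} (hK : Continuous K) {D M : ℝ}
    (hb : ∀ v, ‖K v‖ ≤ D * Real.exp (M * |v| - v ^ 2)) (c : ℝ) {y : ℝ} (hy : 0 < y) :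
    Integrable fun v : ℝ ↦ (y : ℂ) ^ ((c : ℂ) - I * v) * K v := by
  refine ((integrable_exp_mul_abs_sub_sq M).const_mul (y ^ c * D)).mono'
    ((continuous_ofReal_cpow_sub_I_mul hy c).mul hK).aestronglyMeasurable (.of_forall fun v ↦ ?_)
  rw [norm_mul, norm_ofReal_cpow_sub_I_mul hy, mul_assoc]
  gcongr
  exact hb v

lemma norm_mul_le_mul_exp {K : ℝ → ℂ} {D M : ℝ}
    (hb : ∀ v, ‖K v‖ ≤ D * Real.exp (M * |v| - v ^ 2)) (c v : ℝ) :
    ‖((c : ℂ) - I * v) * K v‖ ≤ Real.exp |c| * D * Real.exp ((M + 1) * |v| - v ^ 2) := by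
  rw [norm_mul]
  calc _ ≤ Real.exp |c| * Real.exp |v| * (D * Real.exp (M * |v| - v ^ 2)) :=
        mul_le_mul (norm_ofReal_sub_I_mul_le c v) (hb v) (norm_nonneg _) (by positivity)
    _ = Real.exp |c| * D * (Real.exp |v| * Real.exp (M * |v| - v ^ 2)) := by ring
    _ = _ := by rw [← Real.exp_add]; ring_nf

lemma hasDerivAt_integral_cpow_mul {K : ℝ → ℂ} (hK : Continuous K) {D M : ℝ}
    (hb : ∀ v, ‖K v‖ ≤ D * Real.exp (M * |v| - v ^ 2)) (c : ℝ) {y : ℝ} (hy : 0 < y) :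
    HasDerivAt (fun y : ℝ ↦ ∫ v : ℝ, (y : ℂ) ^ ((c : ℂ) - I * v) * K v)
      (∫ v : ℝ, (y : ℂ) ^ (((c - 1 : ℝ) : ℂ) - I * v) * (((c : ℂ) - I * v) * K v)) y := by
  have hb' := norm_mul_le_mul_exp hb c
  set B := (y / 2) ^ (c - 1) + (2 * y) ^ (c - 1)
  refine (hasDerivAt_integral_of_dominated_loc_of_deriv_le
    (s := Set.Ioo (y / 2) (2 * y))
    (F' := fun y v ↦ (y : ℂ) ^ (((c - 1 : ℝ) : ℂ) - I * v) * (((c : ℂ) - I * v) * K v))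
    (bound := fun v ↦ B * (Real.exp |c| * D * Real.exp ((M + 1) * |v| - v ^ 2)))
    (Ioo_mem_nhds (by linarith) (by linarith)) ?_ (integrable_cpow_mul hK hb c hy) ?_ ?_ ?_ ?_).2
  · filter_upwards [lt_mem_nhds hy] with x hx
    exact (integrable_cpow_mul hK hb c hx).aestronglyMeasurable
  · exact (integrable_cpow_mul (by fun_prop) hb' (c - 1) hy).aestronglyMeasurable
  · refine .of_forall fun v x hx ↦ ?_
    have hx0 : 0 < x := by linarith [hx.1]
    rw [norm_mul, norm_ofReal_cpow_sub_I_mul hx0]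
    refine mul_le_mul ?_ (hb' v) (norm_nonneg _) (by positivity)
    have p1 : 0 ≤ (y / 2) ^ (c - 1) := by positivity
    have p2 : 0 ≤ (2 * y) ^ (c - 1) := by positivity
    rcases le_total 0 (c - 1) with h | h
    · linarith [Real.rpow_le_rpow hx0.le hx.2.le h]
    · linarith [Real.rpow_le_rpow_of_nonpos (by positivity) hx.1.le h]
  · exact ((integrable_exp_mul_abs_sub_sq (M + 1)).const_mul _).const_mul _
  · refine .of_forall fun v x hx ↦ ?_
    have hx0 : 0 < x := by linarith [hx.1]
    have h := ((hasStrictDerivAt_cpow_const (c := (c : ℂ) - I * v)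
      (ofReal_mem_slitPlane.2 hx0)).hasDerivAt.comp_ofReal).mul_const (K v)
    refine h.congr_deriv ?_
    have : ((c - 1 : ℝ) : ℂ) - I * v = (c : ℂ) - I * v - 1 := by push_cast; ring
    rw [this]; ring

lemma norm_prod_sub_I_mul_le {K : ℝ → ℂ} {D M : ℝ}
    (hb : ∀ v, ‖K v‖ ≤ D * Real.exp (M * |v| - v ^ 2)) (c : ℝ) (k : ℕ) (v : ℝ) :
    ‖(∏ j ∈ Finset.range k, (((c - j : ℝ) : ℂ) - I * v)) * K v‖ ≤
      (∏ j ∈ Finset.range k, Real.exp |c - j|) * D * Real.exp ((M + k) * |v| - v ^ 2) := by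
  induction k with
  | zero => simpa using hb v
  | succ k ih =>
    rw [Finset.prod_range_succ_comm, Finset.prod_range_succ_comm, mul_assoc, norm_mul]
    calc _ ≤ Real.exp |c - k| * Real.exp |v| * ((∏ j ∈ Finset.range k, Real.exp |c - j|) * D *
          Real.exp ((M + k) * |v| - v ^ 2)) :=
          mul_le_mul (norm_ofReal_sub_I_mul_le _ v) ih (norm_nonneg _) (by positivity)
      _ = Real.exp |c - k| * (∏ j ∈ Finset.range k, Real.exp |c - j|) * D *
          (Real.exp |v| * Real.exp ((M + k) * |v| - v ^ 2)) := by ring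
      _ = _ := by rw [← Real.exp_add]; push_cast; ring_nf

lemma iteratedDeriv_integral_cpow_mul {K : ℝ → ℂ} (hK : Continuous K) {D M : ℝ}
    (hb : ∀ v, ‖K v‖ ≤ D * Real.exp (M * |v| - v ^ 2)) (c : ℝ) (k : ℕ) {y : ℝ} (hy : 0 < y) :
    iteratedDeriv k (fun y : ℝ ↦ ∫ v : ℝ, (y : ℂ) ^ ((c : ℂ) - I * v) * K v) y =
      ∫ v : ℝ, (y : ℂ) ^ (((c - k : ℝ) : ℂ) - I * v) *
        ((∏ j ∈ Finset.range k, (((c - j : ℝ) : ℂ) - I * v)) * K v) := by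
  induction k generalizing y with
  | zero => simp
  | succ k ih =>
    rw [iteratedDeriv_succ]
    have h : iteratedDeriv k (fun y : ℝ ↦ ∫ v : ℝ, (y : ℂ) ^ ((c : ℂ) - I * v) * K v) =ᶠ[nhds y]
        fun y ↦ ∫ v : ℝ, (y : ℂ) ^ (((c - k : ℝ) : ℂ) - I * v) *
          ((∏ j ∈ Finset.range k, (((c - j : ℝ) : ℂ) - I * v)) * K v) := by
      filter_upwards [lt_mem_nhds hy] with x hx using ih hx
    rw [h.deriv_eq, (hasDerivAt_integral_cpow_mul (by fun_prop)
      (norm_prod_sub_I_mul_le hb c k) (c - k) hy).deriv]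
    refine integral_congr_ae (.of_forall fun v ↦ ?_)
    have : c - ((k + 1 : ℕ) : ℝ) = c - k - 1 := by push_cast; ring
    simp only [this, Finset.prod_range_succ_comm, mul_assoc]

lemma exists_norm_pow_mul_iteratedDeriv_le (c M : ℝ) (k : ℕ) :
    ∃ C : ℝ, 0 < C ∧ ∀ (K : ℝ → ℂ) (D : ℝ), Continuous K →
      (∀ v, ‖K v‖ ≤ D * Real.exp (M * |v| - v ^ 2)) → ∀ y : ℝ, 0 < y →
      ‖(y : ℂ) ^ k *
        iteratedDeriv k (fun y : ℝ ↦ ∫ v : ℝ, (y : ℂ) ^ ((c : ℂ) - I * v) * K v) y‖ ≤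
        C * D * y ^ c := by
  have hI : 0 < ∫ v : ℝ, Real.exp ((M + k) * |v| - v ^ 2) :=
    integral_exp_pos (integrable_exp_mul_abs_sub_sq _)
  refine ⟨(∏ j ∈ Finset.range k, Real.exp |c - j|) *
    ∫ v : ℝ, Real.exp ((M + k) * |v| - v ^ 2),
    mul_pos (Finset.prod_pos fun _ _ ↦ Real.exp_pos _) hI, fun K D hK hb y hy ↦ ?_⟩
  rw [iteratedDeriv_integral_cpow_mul hK hb c k hy, norm_mul, norm_pow, norm_real,
    Real.norm_of_nonneg hy.le]
  have h := norm_integral_le_of_norm_le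
    (((integrable_exp_mul_abs_sub_sq (M + k)).const_mul
      (y ^ (c - k) * ((∏ j ∈ Finset.range k, Real.exp |c - j|) * D))))
    (f := fun v : ℝ ↦ (y : ℂ) ^ (((c - k : ℝ) : ℂ) - I * v) *
        ((∏ j ∈ Finset.range k, (((c - j : ℝ) : ℂ) - I * v)) * K v))
    (.of_forall fun v ↦ by
      rw [norm_mul, norm_ofReal_cpow_sub_I_mul hy, mul_assoc]
      gcongr
      exact norm_prod_sub_I_mul_le hb c k v)
  rw [integral_const_mul] at h
  calc _ ≤ y ^ k * _ := mul_le_mul_of_nonneg_left h (by positivity)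
    _ = (y ^ k * y ^ (c - k)) * _ := by rw [mul_assoc (y ^ (c - k)), ← mul_assoc]
    _ = y ^ c * _ := by
      rw [← Real.rpow_natCast, ← Real.rpow_add hy, add_sub_cancel]
    _ = _ := by ring

lemma integral_inv_add_I_mul {c : ℝ} (hc : c ≠ 0) (T : ℝ) :
    ∫ v in (-T)..T, ((c : ℂ) + v * I)⁻¹ = 2 * Real.arctan (T / c) := by
  have hne (v : ℝ) : (c : ℂ) + v * I ≠ 0 := fun h ↦ hc (by simpa using congrArg re h)
  have hd : ∀ v ∈ Set.uIcc (-T) T,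
      HasDerivAt (fun v : ℝ ↦ ((Real.arctan (v / c) : ℝ) : ℂ) -
        I / 2 * ((Real.log (c ^ 2 + v ^ 2) : ℝ) : ℂ)) (((c : ℂ) + v * I)⁻¹) v := by
    intro v _
    have hp : 0 < c ^ 2 + v ^ 2 := by positivity
    have h1 := ((hasDerivAt_id v).div_const c).arctan.ofReal_comp
    have h2 := (((hasDerivAt_pow 2 v).const_add (c ^ 2)).log hp.ne').ofReal_comp
    refine (h1.sub (h2.const_mul (I / 2))).congr_deriv ?_
    have hp' : (c : ℂ) ^ 2 + v ^ 2 ≠ 0 := by exact_mod_cast hp.ne'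
    have hc' : (c : ℂ) ≠ 0 := by exact_mod_cast hc
    have e : ((c : ℂ) + v * I)⁻¹ = (c - v * I) / (c ^ 2 + v ^ 2) := by
      rw [inv_eq_one_div, div_eq_div_iff (hne v) hp']
      ring_nf
      rw [I_sq]; ring
    have e3 : (1 : ℂ) + (v / c) ^ 2 ≠ 0 := by
      have : (1 : ℂ) + (v / c) ^ 2 = (c ^ 2 + v ^ 2) / c ^ 2 := by field_simp
      rw [this]
      exact div_ne_zero hp' (pow_ne_zero 2 hc')
    rw [e]
    push_cast
    simp only [id]
    field_simp
  rw [intervalIntegral.integral_eq_sub_of_hasDerivAt hd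
    ((Continuous.inv₀ (by fun_prop) hne).intervalIntegrable _ _)]
  simp only [neg_sq, neg_div, Real.arctan_neg]
  push_cast; ring

/-- Moving a vertical line of integration of `G u / u` across the simple pole at `0`. -/
lemma integral_line_div_eq_add_two_pi {G : ℂ → ℂ} {U : Set ℂ} {a b D : ℝ} (ha : 0 < a) (hb : 0 < b)
    (hU : IsOpen U) (hsub : ∀ u : ℂ, -a ≤ u.re → u.re ≤ b → u ∈ U)
    (hG : DifferentiableOn ℂ G U) (h0 : G 0 = 1)
    (hbd : ∀ u : ℂ, -a ≤ u.re → u.re ≤ b → ‖G u‖ ≤ D * Real.exp (-u.im ^ 2)) :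
    ∫ v : ℝ, G (b + v * I) / (b + v * I) =
      (∫ v : ℝ, G ((-a : ℝ) + v * I) / ((-a : ℝ) + v * I)) + 2 * Real.pi := by
  have hD : 0 ≤ D := by
    have := (norm_nonneg _).trans (hbd 0 (by simpa using ha.le) (by simpa using hb.le))
    simpa using this
  have hne {c : ℝ} (hc : c ≠ 0) (v : ℝ) : (c : ℂ) + v * I ≠ 0 :=
    fun h ↦ hc (by simpa using congrArg re h)
  have hcont {c : ℝ} (hc : c ≠ 0) (h1 : -a ≤ c) (h2 : c ≤ b) :
      Continuous fun v : ℝ ↦ G (c + v * I) / (c + v * I) := by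
    refine Continuous.div ?_ (by fun_prop) (hne hc)
    exact hG.continuousOn.comp_continuous (by fun_prop)
      fun v ↦ hsub _ (by simpa using h1) (by simpa using h2)
  have hgint {c : ℝ} (hc : c ≠ 0) (h1 : -a ≤ c) (h2 : c ≤ b) :
      Integrable fun v : ℝ ↦ G (c + v * I) / (c + v * I) := by
    refine ((integrable_exp_mul_abs_sub_sq 0).const_mul (D / |c|)).mono'
      (hcont hc h1 h2).aestronglyMeasurable (.of_forall fun v ↦ ?_)
    have k1 := hbd (c + v * I) (by simpa using h1) (by simpa using h2)
    have k2 : |c| ≤ ‖(c : ℂ) + v * I‖ := by simpa using abs_re_le_norm ((c : ℂ) + v * I)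
    have k3 : 0 < |c| := abs_pos.2 hc
    simp only [add_im, ofReal_im, mul_im, ofReal_re, I_im, mul_one, I_re, mul_zero, add_zero,
      zero_add] at k1
    rw [norm_div, zero_mul, zero_sub, div_mul_eq_mul_div]
    gcongr
  have hlim {c : ℝ} (hc : c ≠ 0) (h1 : -a ≤ c) (h2 : c ≤ b) :=
    intervalIntegral_tendsto_integral (hgint hc h1 h2) Filter.tendsto_neg_atTop_atBot
      Filter.tendsto_id
  have hmem : U ∈ nhds (0 : ℂ) := hU.mem_nhds (hsub 0 (by simpa using ha.le) (by simpa using hb.le))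
  have hg := (differentiableOn_dslope hmem).2 hG
  set g := dslope G 0 with hgdef
  have hgne {u : ℂ} (hu : u ≠ 0) : g u = G u / u - u⁻¹ := by
    rw [hgdef, dslope_of_ne _ hu, slope_def_field, h0, sub_zero, sub_div, one_div]
  have hvert {c : ℝ} (hc : c ≠ 0) (h1 : -a ≤ c) (h2 : c ≤ b) (T : ℝ) :
      ∫ v in (-T)..T, g (c + v * I) =
        (∫ v in (-T)..T, G (c + v * I) / (c + v * I)) - 2 * Real.arctan (T / c) := by
    have hinv : Continuous fun v : ℝ ↦ ((c : ℂ) + v * I)⁻¹ :=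
      Continuous.inv₀ (by fun_prop) (hne hc)
    rw [← integral_inv_add_I_mul hc, ← intervalIntegral.integral_sub
      ((hcont hc h1 h2).intervalIntegrable _ _) (hinv.intervalIntegrable _ _)]
    exact intervalIntegral.integral_congr fun v _ ↦ hgne (hne hc v)
  have hhor {T : ℝ} (hT : T ≠ 0) :
      ‖∫ x in (-a)..b, g (x + T * I)‖ ≤ (D + 1) / |T| * |b - -a| := by
    refine intervalIntegral.norm_integral_le_of_norm_le_const fun x hx ↦ ?_
    rw [Set.uIoc_of_le (by linarith)] at hx
    have hx0 : (x : ℂ) + T * I ≠ 0 := fun h ↦ hT (by simpa using congrArg im h)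
    have k1 := hbd (x + T * I) (by simpa using hx.1.le) (by simpa using hx.2)
    have k2 : |T| ≤ ‖(x : ℂ) + T * I‖ := by simpa using abs_im_le_norm ((x : ℂ) + T * I)
    have k3 : 0 < |T| := abs_pos.2 hT
    have k4 : Real.exp (-((x : ℂ) + T * I).im ^ 2) ≤ 1 := Real.exp_le_one_iff.2 (by
      nlinarith [sq_nonneg (((x : ℂ) + T * I).im)])
    have k5 : ‖G (x + T * I)‖ ≤ D := k1.trans (by nlinarith)
    rw [hgne hx0, ← one_div, ← sub_div, norm_div]
    gcongr
    exact (norm_sub_le _ _).trans (by simpa using k5)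
  have hrect (T : ℝ) := integral_boundary_rect_eq_zero_of_differentiableOn g
    (-a + (-T : ℝ) * I) (b + T * I) (hg.mono fun u hu ↦ by
      rw [mem_reProdIm] at hu
      have := hu.1
      simp only [add_re, neg_re, ofReal_re, mul_re, I_re, mul_zero, ofReal_im, I_im, mul_one,
        sub_self, add_zero] at this
      rw [Set.uIcc_of_le (by linarith)] at this
      exact hsub u this.1 this.2)
  have hz : Filter.Tendsto (fun T : ℝ ↦ (D + 1) / |T| * |b - -a|) Filter.atTop (nhds 0) := by
    have : Filter.Tendsto (fun T : ℝ ↦ (D + 1) / |T|) Filter.atTop (nhds 0) :=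
      Filter.Tendsto.const_div_atTop Filter.tendsto_abs_atTop_atTop _
    simpa using this.mul_const |b - -a|
  have z1 : Filter.Tendsto (fun T : ℝ ↦ ∫ x in (-a)..b, g (x + T * I)) Filter.atTop (nhds 0) := by
    refine squeeze_zero_norm' ?_ hz
    filter_upwards [Filter.eventually_gt_atTop 0] with T hT using hhor hT.ne'
  have z2 : Filter.Tendsto (fun T : ℝ ↦ ∫ x in (-a)..b, g (x + (-T : ℝ) * I))
      Filter.atTop (nhds 0) := by
    refine squeeze_zero_norm' ?_ hz
    filter_upwards [Filter.eventually_gt_atTop 0] with T hT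
    simpa using hhor (neg_ne_zero.2 hT.ne')
  have harc {c : ℝ} (hc : 0 < c) : Filter.Tendsto (fun T : ℝ ↦ (2 : ℂ) * Real.arctan (T / c))
      Filter.atTop (nhds Real.pi) := by
    have h1 := Real.tendsto_arctan_atTop.mono_right nhdsWithin_le_nhds |>.comp
      (Filter.tendsto_id.atTop_div_const hc)
    have h2 := ((continuous_ofReal.tendsto _).comp h1).const_mul 2
    have : (2 : ℂ) * ((Real.pi / 2 : ℝ) : ℂ) = Real.pi := by push_cast; ring
    rwa [this] at h2
  have hfin := ((z1.sub z2).const_mul (-I)).add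
    (((harc hb).add (harc ha)).add (hlim (neg_ne_zero.2 ha.ne') le_rfl (by linarith)))
  have hfin2 := hlim hb.ne' (by linarith) le_rfl
  have hkey := tendsto_nhds_unique (hfin2.congr fun T ↦ ?_) hfin
  · rw [hkey]; ring
  · have h := hrect T
    simp only [add_re, neg_re, ofReal_re, mul_re, I_re, mul_zero, ofReal_im, I_im, mul_one,
        sub_self, add_zero, add_im, neg_im, mul_im, zero_add, neg_zero, smul_eq_mul] at h
    have v1 := hvert hb.ne' (by linarith) le_rfl T
    have v2 := hvert (neg_ne_zero.2 ha.ne') le_rfl (by linarith) T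
    rw [div_neg, Real.arctan_neg, ofReal_neg (Real.arctan _)] at v2
    rw [v1, v2] at h
    simp only [id]
    linear_combination (-I) * h + ((∫ v in (-T)..T, G (b + v * I) / (b + v * I)) -
      (∫ v in (-T)..T, G ((-a : ℝ) + v * I) / ((-a : ℝ) + v * I)) -
        2 * (Real.arctan (T / b) : ℂ) - 2 * (Real.arctan (T / a) : ℂ)) * I_sq

/-- The quotient `Γ((s + u - α) / 2) / Γ((s - α) / 2)`. -/
noncomputable def gammaQuot (α s u : ℂ) : ℂ :=
  Gamma ((s + u - α) / 2) / Gamma ((s - α) / 2)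

lemma gammaQuot_zero {α s : ℂ} (h : α.re < s.re) : gammaQuot α s 0 = 1 := by
  have : Gamma ((s - α) / 2) ≠ 0 := Gamma_ne_zero_of_re_pos (by simp; linarith)
  simp [gammaQuot, this]

lemma differentiableOn_gammaQuot {α s : ℂ} {r : ℝ} (h : α.re + r ≤ s.re) :
    DifferentiableOn ℂ (gammaQuot α s) {u | -r < u.re} := by
  intro u hu
  have hu' : -r < u.re := hu
  refine DifferentiableAt.differentiableWithinAt (DifferentiableAt.div_const ?_ _)
  have hG : DifferentiableAt ℂ Gamma ((s + u - α) / 2) := by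
    refine differentiableAt_Gamma _ fun m hm ↦ ?_
    have := congrArg re hm
    simp at this
    have : (0 : ℝ) ≤ m := m.cast_nonneg
    linarith
  exact hG.comp u (by fun_prop)

lemma exists_norm_gammaQuot_le_of_mem_strip {α s : ℂ} {a : ℝ} (h : α.re + a < s.re) (b : ℝ) :
    ∃ D : ℝ, ∀ u : ℂ, -a ≤ u.re → u.re ≤ b → ‖gammaQuot α s u‖ ≤ D := by
  have hcont : ContinuousOn Real.Gamma
      (Set.Icc ((s.re - a - α.re) / 2) ((s.re + b - α.re) / 2)) := fun x hx ↦ by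
    refine (Real.differentiableAt_Gamma fun m hm ↦ ?_).continuousAt.continuousWithinAt
    have : (0 : ℝ) ≤ m := m.cast_nonneg
    linarith [hx.1]
  obtain ⟨D, hD⟩ := isCompact_Icc.exists_bound_of_continuousOn hcont
  refine ⟨D / ‖Gamma ((s - α) / 2)‖, fun u h1 h2 ↦ ?_⟩
  have e : ((s + u - α) / 2).re = (s.re + u.re - α.re) / 2 := by simp
  rw [gammaQuot, norm_div]
  gcongr
  refine (norm_Gamma_le_Gamma_re (by rw [e]; linarith)).trans ((le_abs_self _).trans ?_)
  exact hD _ (by rw [e]; constructor <;> linarith)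

lemma exists_norm_gammaQuot_line_le {α : ℂ} {a : ℝ} (ha : 0 ≤ a) (hα : |α.re| + a < 1 / 2) :
    ∃ C : ℝ, 0 < C ∧ ∀ (s : ℂ) (v : ℝ), s.re = 1 / 2 →
      ‖gammaQuot α s ((-a : ℝ) + v * I)‖ ≤
        C * (1 + |s.im|) ^ (-(a / 2)) * Real.exp (2 * |v|) := by
  have hα1 := le_abs_self α.re
  have hα2 := neg_abs_le α.re
  obtain ⟨C, hC, h⟩ := exists_norm_Gamma_le_rpow_mul_norm_Gamma (x := (1 / 2 - α.re) / 2)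
    (b := a / 2) (by linarith) (by linarith) (by linarith)
  refine ⟨C * (2 + |α.im|) ^ (a / 2), by positivity, fun s v hs ↦ ?_⟩
  have k := h ((s - α) / 2) ((s + ((-a : ℝ) + v * I) - α) / 2) (by simp [hs])
    (by simp [hs]; ring)
  have hpos : 0 < ‖Gamma ((s - α) / 2)‖ :=
    norm_pos_iff.2 (Gamma_ne_zero_of_re_pos (by simp [hs]; linarith))
  have e1 : ((s + ((-a : ℝ) + v * I) - α) / 2).im - ((s - α) / 2).im = v / 2 := by
    simp; ring
  have e2 : ((s - α) / 2).im = (s.im - α.im) / 2 := by simp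
  rw [e1, e2] at k
  have l1 : 1 + |s.im| ≤ (2 + |α.im|) * (1 + |(s.im - α.im) / 2|) := by
    have h1 := abs_sub_abs_le_abs_sub s.im α.im
    have h2 : |s.im - α.im| = 2 * |(s.im - α.im) / 2| := by
      rw [abs_div, abs_two]; ring
    nlinarith [abs_nonneg α.im, abs_nonneg ((s.im - α.im) / 2)]
  have l2 : (1 + |(s.im - α.im) / 2|) ^ (-(a / 2)) ≤
      (2 + |α.im|) ^ (a / 2) * (1 + |s.im|) ^ (-(a / 2)) := by
    have h1 := Real.rpow_le_rpow (by positivity) l1 (show 0 ≤ a / 2 by linarith)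
    rw [Real.mul_rpow (by positivity) (by positivity)] at h1
    rw [Real.rpow_neg (by positivity), Real.rpow_neg (by positivity), ← div_eq_mul_inv,
      inv_eq_one_div, div_le_div_iff₀ (by positivity) (by positivity), one_mul]
    exact h1
  have l3 : Real.exp (3 * |v / 2|) ≤ Real.exp (2 * |v|) := by
    rw [Real.exp_le_exp, abs_div, abs_two]
    linarith [abs_nonneg v]
  rw [gammaQuot, norm_div, div_le_iff₀ hpos]
  calc _ ≤ _ := k
    _ ≤ C * ((2 + |α.im|) ^ (a / 2) * (1 + |s.im|) ^ (-(a / 2))) * Real.exp (2 * |v|) *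
        ‖Gamma ((s - α) / 2)‖ := by gcongr
    _ = _ := by ring

/-- The product of the six Gamma quotients in `Vweight`. -/
noncomputable def gammaQuotProd (α₁ α₂ α₃ : ℂ) (t : ℝ) (u : ℂ) : ℂ :=
  gammaQuot α₁ (1 / 2 + I * t) u * gammaQuot α₂ (1 / 2 + I * t) u *
    gammaQuot α₃ (1 / 2 + I * t) u * gammaQuot α₁ (1 / 2 - I * t) u *
    gammaQuot α₂ (1 / 2 - I * t) u * gammaQuot α₃ (1 / 2 - I * t) u

section gammaQuotProd

variable {α₁ α₂ α₃ : ℂ} {r a : ℝ}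

lemma gammaQuotProd_zero (h₁ : α₁.re < 1 / 2) (h₂ : α₂.re < 1 / 2) (h₃ : α₃.re < 1 / 2) (t : ℝ) :
    gammaQuotProd α₁ α₂ α₃ t 0 = 1 := by
  have e1 : (1 / 2 + I * t : ℂ).re = 1 / 2 := by simp
  have e2 : (1 / 2 - I * t : ℂ).re = 1 / 2 := by simp
  rw [gammaQuotProd, gammaQuot_zero (by rwa [e1]), gammaQuot_zero (by rwa [e1]),
    gammaQuot_zero (by rwa [e1]), gammaQuot_zero (by rwa [e2]), gammaQuot_zero (by rwa [e2]),
    gammaQuot_zero (by rwa [e2])]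
  norm_num

lemma differentiableOn_gammaQuotProd (h₁ : α₁.re + r ≤ 1 / 2) (h₂ : α₂.re + r ≤ 1 / 2)
    (h₃ : α₃.re + r ≤ 1 / 2) (t : ℝ) :
    DifferentiableOn ℂ (gammaQuotProd α₁ α₂ α₃ t) {u | -r < u.re} := by
  have e1 : (1 / 2 + I * t : ℂ).re = 1 / 2 := by simp
  have e2 : (1 / 2 - I * t : ℂ).re = 1 / 2 := by simp
  exact (((((differentiableOn_gammaQuot (by rwa [e1])).mul
    (differentiableOn_gammaQuot (by rwa [e1]))).mul
    (differentiableOn_gammaQuot (by rwa [e1]))).mul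
    (differentiableOn_gammaQuot (by rwa [e2]))).mul
    (differentiableOn_gammaQuot (by rwa [e2]))).mul
    (differentiableOn_gammaQuot (by rwa [e2]))

lemma exists_norm_gammaQuotProd_le_of_mem_strip (h₁ : α₁.re + a < 1 / 2) (h₂ : α₂.re + a < 1 / 2)
    (h₃ : α₃.re + a < 1 / 2) (b t : ℝ) :
    ∃ D : ℝ, ∀ u : ℂ, -a ≤ u.re → u.re ≤ b → ‖gammaQuotProd α₁ α₂ α₃ t u‖ ≤ D := by
  have e1 : (1 / 2 + I * t : ℂ).re = 1 / 2 := by simp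
  have e2 : (1 / 2 - I * t : ℂ).re = 1 / 2 := by simp
  obtain ⟨D₁, k₁⟩ := exists_norm_gammaQuot_le_of_mem_strip (s := 1 / 2 + I * t) (by rwa [e1]) b
    (α := α₁) (a := a)
  obtain ⟨D₂, k₂⟩ := exists_norm_gammaQuot_le_of_mem_strip (s := 1 / 2 + I * t) (by rwa [e1]) b
    (α := α₂) (a := a)
  obtain ⟨D₃, k₃⟩ := exists_norm_gammaQuot_le_of_mem_strip (s := 1 / 2 + I * t) (by rwa [e1]) b
    (α := α₃) (a := a)
  obtain ⟨D₄, k₄⟩ := exists_norm_gammaQuot_le_of_mem_strip (s := 1 / 2 - I * t) (by rwa [e2]) b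
    (α := α₁) (a := a)
  obtain ⟨D₅, k₅⟩ := exists_norm_gammaQuot_le_of_mem_strip (s := 1 / 2 - I * t) (by rwa [e2]) b
    (α := α₂) (a := a)
  obtain ⟨D₆, k₆⟩ := exists_norm_gammaQuot_le_of_mem_strip (s := 1 / 2 - I * t) (by rwa [e2]) b
    (α := α₃) (a := a)
  refine ⟨D₁ * D₂ * D₃ * D₄ * D₅ * D₆, fun u h h' ↦ ?_⟩
  have p₁ := (norm_nonneg _).trans (k₁ u h h')
  have p₂ := (norm_nonneg _).trans (k₂ u h h')
  have p₃ := (norm_nonneg _).trans (k₃ u h h')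
  have p₄ := (norm_nonneg _).trans (k₄ u h h')
  have p₅ := (norm_nonneg _).trans (k₅ u h h')
  rw [gammaQuotProd, norm_mul, norm_mul, norm_mul, norm_mul, norm_mul]
  gcongr
  exacts [k₁ u h h', k₂ u h h', k₃ u h h', k₄ u h h', k₅ u h h', k₆ u h h']

lemma exists_norm_gammaQuotProd_line_le (ha : 0 ≤ a) (h₁ : |α₁.re| + a < 1 / 2)
    (h₂ : |α₂.re| + a < 1 / 2) (h₃ : |α₃.re| + a < 1 / 2) :
    ∃ C : ℝ, 0 < C ∧ ∀ t v : ℝ, ‖gammaQuotProd α₁ α₂ α₃ t ((-a : ℝ) + v * I)‖ ≤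
      C * (1 + |t|) ^ (-(3 * a)) * Real.exp (12 * |v|) := by
  obtain ⟨C₁, hC₁, k₁⟩ := exists_norm_gammaQuot_line_le ha h₁
  obtain ⟨C₂, hC₂, k₂⟩ := exists_norm_gammaQuot_line_le ha h₂
  obtain ⟨C₃, hC₃, k₃⟩ := exists_norm_gammaQuot_line_le ha h₃
  refine ⟨(C₁ * C₂ * C₃) ^ 2, by positivity, fun t v ↦ ?_⟩
  have e1 : (1 / 2 + I * t : ℂ).re = 1 / 2 := by simp
  have e2 : (1 / 2 - I * t : ℂ).re = 1 / 2 := by simp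
  have i1 : |(1 / 2 + I * t : ℂ).im| = |t| := by simp
  have i2 : |(1 / 2 - I * t : ℂ).im| = |t| := by simp
  have m₁ := k₁ _ v e1
  have m₂ := k₂ _ v e1
  have m₃ := k₃ _ v e1
  have m₄ := k₁ _ v e2
  have m₅ := k₂ _ v e2
  have m₆ := k₃ _ v e2
  rw [i1] at m₁ m₂ m₃
  rw [i2] at m₄ m₅ m₆
  have e : (1 + |t|) ^ (-(3 * a)) * Real.exp (12 * |v|) =
      ((1 + |t|) ^ (-(a / 2))) ^ 6 * Real.exp (2 * |v|) ^ 6 := by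
    rw [← Real.rpow_mul_natCast (by positivity), ← Real.exp_nat_mul]
    push_cast
    ring_nf
  rw [mul_assoc, e, gammaQuotProd, norm_mul, norm_mul, norm_mul, norm_mul, norm_mul]
  set A := (1 + |t|) ^ (-(a / 2))
  have hA : 0 ≤ A := by positivity
  set E := Real.exp (2 * |v|)
  have hE : 0 ≤ E := by positivity
  calc _ ≤ C₁ * A * E * (C₂ * A * E) * (C₃ * A * E) * (C₁ * A * E) * (C₂ * A * E) *
        (C₃ * A * E) := by gcongr
    _ = _ := by ring

end gammaQuotProd

/-- The integrand `G` of `Vweight`, without the factor `1 / u`. -/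
noncomputable def weightIntegrand (α₁ α₂ α₃ : ℂ) (t y : ℝ) (u : ℂ) : ℂ :=
  ((Real.pi ^ 2 * y : ℝ) : ℂ) ^ (-u) * gammaQuotProd α₁ α₂ α₃ t u * exp (u ^ 2)

/-- The kernel against which `y ^ (a - iv)` is integrated after shifting the line of integration
in `Vweight` to `Re u = -a`. -/
noncomputable def weightKernel (α₁ α₂ α₃ : ℂ) (a t v : ℝ) : ℂ :=
  1 / (2 * Real.pi) * (((Real.pi ^ 2 : ℝ) : ℂ) ^ ((a : ℂ) - I * v) *
    gammaQuotProd α₁ α₂ α₃ t ((-a : ℝ) + v * I) * exp (((-a : ℝ) + v * I) ^ 2) /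
      ((-a : ℝ) + v * I))

lemma Vweight_eq_integral_weightIntegrand (α₁ α₂ α₃ : ℂ) (t y : ℝ) :
    Vweight α₁ α₂ α₃ t y = 1 / (2 * Real.pi) *
      ∫ v : ℝ, weightIntegrand α₁ α₂ α₃ t y ((3 : ℝ) + v * I) / ((3 : ℝ) + v * I) := by
  rw [Vweight]
  congr 1
  refine integral_congr_ae (.of_forall fun v ↦ ?_)
  simp only [weightIntegrand, gammaQuotProd, gammaQuot, mul_comm (v : ℂ) I, ofReal_ofNat]
  ring

lemma norm_exp_sq (u : ℂ) : ‖exp (u ^ 2)‖ = Real.exp (u.re ^ 2 - u.im ^ 2) := by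
  rw [norm_exp, sq, mul_re, sq, sq]

section weight

variable {α₁ α₂ α₃ : ℂ} {a : ℝ}

lemma exists_norm_weightIntegrand_le_of_mem_strip (h₁ : α₁.re + a < 1 / 2)
    (h₂ : α₂.re + a < 1 / 2) (h₃ : α₃.re + a < 1 / 2) (b t : ℝ) {y : ℝ} (hy : 0 < y) :
    ∃ D : ℝ, ∀ u : ℂ, -a ≤ u.re → u.re ≤ b →
      ‖weightIntegrand α₁ α₂ α₃ t y u‖ ≤ D * Real.exp (-u.im ^ 2) := by
  obtain ⟨D, hD⟩ := exists_norm_gammaQuotProd_le_of_mem_strip h₁ h₂ h₃ b t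
  have hY : 0 < Real.pi ^ 2 * y := by positivity
  have hcont : Continuous fun x : ℝ ↦ (Real.pi ^ 2 * y) ^ (-x) * Real.exp (x ^ 2) := by
    have := hY.ne'
    fun_prop (disch := assumption)
  obtain ⟨B, hB⟩ := (isCompact_Icc (a := -a) (b := b)).exists_bound_of_continuousOn
    hcont.continuousOn
  refine ⟨D * B, fun u h h' ↦ ?_⟩
  have h0 := (norm_nonneg _).trans (hD u h h')
  have hB' := (le_abs_self _).trans (hB u.re ⟨h, h'⟩)
  rw [weightIntegrand, norm_mul, norm_mul, norm_cpow_eq_rpow_re_of_pos hY, norm_exp_sq, neg_re,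
    sub_eq_add_neg, Real.exp_add]
  calc _ = ‖gammaQuotProd α₁ α₂ α₃ t u‖ * ((Real.pi ^ 2 * y) ^ (-u.re) * Real.exp (u.re ^ 2)) *
        Real.exp (-u.im ^ 2) := by ring
    _ ≤ _ := by
      gcongr
      exact hD u h h'

lemma Vweight_eq_one_add_integral {r : ℝ} (ha : 0 < a) (har : a < r) (h₁ : α₁.re + r ≤ 1 / 2)
    (h₂ : α₂.re + r ≤ 1 / 2) (h₃ : α₃.re + r ≤ 1 / 2) (t : ℝ) {y : ℝ} (hy : 0 < y) :
    Vweight α₁ α₂ α₃ t y =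
      1 + ∫ v : ℝ, (y : ℂ) ^ ((a : ℂ) - I * v) * weightKernel α₁ α₂ α₃ a t v := by
  have hY : ((Real.pi ^ 2 * y : ℝ) : ℂ) ≠ 0 := by
    rw [ofReal_ne_zero]; positivity
  obtain ⟨D, hD⟩ := exists_norm_weightIntegrand_le_of_mem_strip (α₁ := α₁) (α₂ := α₂)
    (α₃ := α₃) (a := a) (by linarith) (by linarith) (by linarith) 3 t hy
  have hd : DifferentiableOn ℂ (weightIntegrand α₁ α₂ α₃ t y) {u | -r < u.re} := by
    refine DifferentiableOn.mul (DifferentiableOn.mul ?_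
      (differentiableOn_gammaQuotProd h₁ h₂ h₃ t)) (by fun_prop)
    exact fun u _ ↦ (DifferentiableAt.const_cpow (by fun_prop)
      (Or.inl hY)).differentiableWithinAt
  have h0 : weightIntegrand α₁ α₂ α₃ t y 0 = 1 := by
    rw [weightIntegrand, gammaQuotProd_zero (by linarith) (by linarith) (by linarith)]
    simp
  rw [Vweight_eq_integral_weightIntegrand, integral_line_div_eq_add_two_pi ha (by norm_num)
    (isOpen_lt continuous_const continuous_re)
    (fun u hu _ ↦ show -r < u.re by linarith) hd h0 hD, mul_add, add_comm,
    ← integral_const_mul]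
  have hpi : (Real.pi : ℂ) ≠ 0 := ofReal_ne_zero.2 Real.pi_ne_zero
  congr 1
  · field_simp
  refine integral_congr_ae (.of_forall fun v ↦ ?_)
  have e : -(((-a : ℝ) : ℂ) + v * I) = (a : ℂ) - I * v := by push_cast; ring
  simp only [weightIntegrand, weightKernel, e]
  rw [ofReal_mul, mul_cpow_ofReal_nonneg (by positivity) hy.le]
  ring

lemma continuous_weightKernel (ha : 0 < a) (h₁ : α₁.re + a < 1 / 2) (h₂ : α₂.re + a < 1 / 2)
    (h₃ : α₃.re + a < 1 / 2) (t : ℝ) : Continuous (weightKernel α₁ α₂ α₃ a t) := by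
  obtain ⟨r, har, hr⟩ : ∃ r, a < r ∧ r < min (min (1 / 2 - α₁.re) (1 / 2 - α₂.re))
      (1 / 2 - α₃.re) :=
    exists_between (by simp only [lt_min_iff]; refine ⟨⟨?_, ?_⟩, ?_⟩ <;> linarith)
  simp only [lt_min_iff] at hr
  have hne (v : ℝ) : ((-a : ℝ) : ℂ) + v * I ≠ 0 := fun h ↦ by
    have := congrArg re h
    simp at this
    linarith
  have hG : Continuous fun v : ℝ ↦ gammaQuotProd α₁ α₂ α₃ t ((-a : ℝ) + v * I) :=
    (differentiableOn_gammaQuotProd (r := r) (by linarith) (by linarith)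
      (by linarith) t).continuousOn.comp_continuous (by fun_prop) fun v ↦ by
        simpa using har
  have hP := continuous_ofReal_cpow_sub_I_mul (y := Real.pi ^ 2) (by positivity) a
  exact continuous_const.mul (((hP.mul hG).mul (by fun_prop)).div (by fun_prop) hne)

lemma exists_norm_weightKernel_le (ha : 0 < a) (h₁ : |α₁.re| + a < 1 / 2)
    (h₂ : |α₂.re| + a < 1 / 2) (h₃ : |α₃.re| + a < 1 / 2) :
    ∃ C : ℝ, 0 < C ∧ ∀ t v : ℝ, ‖weightKernel α₁ α₂ α₃ a t v‖ ≤
      C * (1 + |t|) ^ (-(3 * a)) * Real.exp (12 * |v| - v ^ 2) := by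
  obtain ⟨C, hC, h⟩ := exists_norm_gammaQuotProd_line_le ha.le h₁ h₂ h₃
  refine ⟨1 / (2 * Real.pi) * ((Real.pi ^ 2) ^ a * C * Real.exp (a ^ 2) / a), by positivity,
    fun t v ↦ ?_⟩
  have hden : a ≤ ‖((-a : ℝ) : ℂ) + v * I‖ := by
    have := abs_re_le_norm (((-a : ℝ) : ℂ) + v * I)
    simpa [abs_of_pos ha] using this
  have hre : (((-a : ℝ) : ℂ) + v * I).re = -a := by simp
  have him : (((-a : ℝ) : ℂ) + v * I).im = v := by simp
  have hpi : ‖(1 / (2 * Real.pi) : ℂ)‖ = 1 / (2 * Real.pi) := by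
    simp [abs_of_pos Real.pi_pos]
  rw [weightKernel, norm_mul, hpi, norm_div, norm_mul, norm_mul, norm_exp_sq, hre, him,
    norm_ofReal_cpow_sub_I_mul (by positivity), neg_sq]
  calc _ ≤ 1 / (2 * Real.pi) * ((Real.pi ^ 2) ^ a *
        (C * (1 + |t|) ^ (-(3 * a)) * Real.exp (12 * |v|)) * Real.exp (a ^ 2 - v ^ 2) / a) := by
        gcongr
        exact h t v
    _ = _ := by
        rw [sub_eq_add_neg, Real.exp_add, sub_eq_add_neg, Real.exp_add]
        ring

end weight

/-- Approximation of the weight function near `y = 0`: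
`y^k V_t^{(k)}(y) = δ_k + O((y/(1+|t|)³)^α)` for
`0 < α ≤ (1/3) min_i (1/2 - |Re αᵢ|)`, where `δ₀ = 1` and `δ_k = 0` for `k ≥ 1`. -/
theorem Vweight_approx (α₁ α₂ α₃ : ℂ)
    (h₁ : |α₁.re| < 1 / 2) (h₂ : |α₂.re| < 1 / 2) (h₃ : |α₃.re| < 1 / 2)
    (k : ℕ) (a : ℝ) (ha : 0 < a)
    (ha' : a ≤ (1 / 3) * min (min (1 / 2 - |α₁.re|) (1 / 2 - |α₂.re|)) (1 / 2 - |α₃.re|)) :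
    ∃ C : ℝ, 0 < C ∧ ∀ (t y : ℝ), 0 < y →
      ‖(y : ℂ) ^ k * iteratedDeriv k (Vweight α₁ α₂ α₃ t) y -
          (if k = 0 then 1 else 0)‖ ≤
        C * (y / (1 + |t|) ^ 3) ^ a := by
  have hm : 3 * a ≤ min (min (1 / 2 - |α₁.re|) (1 / 2 - |α₂.re|)) (1 / 2 - |α₃.re|) := by
    linarith
  simp only [le_min_iff] at hm
  obtain ⟨⟨m₁, m₂⟩, m₃⟩ := hm
  have n₁ := le_abs_self α₁.re
  have n₂ := le_abs_self α₂.re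
  have n₃ := le_abs_self α₃.re
  obtain ⟨C, hC, hK⟩ := exists_norm_weightKernel_le (α₁ := α₁) (α₂ := α₂) (α₃ := α₃) ha
    (by linarith) (by linarith) (by linarith)
  obtain ⟨B, hB, h⟩ := exists_norm_pow_mul_iteratedDeriv_le a 12 k
  refine ⟨B * C, by positivity, fun t y hy ↦ ?_⟩
  have key := h _ _ (continuous_weightKernel (α₁ := α₁) (α₂ := α₂) (α₃ := α₃) ha (by linarith)
    (by linarith) (by linarith) t) (hK t) y hy
  have hV : Vweight α₁ α₂ α₃ t =ᶠ[nhds y] fun y : ℝ ↦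
      1 + ∫ v : ℝ, (y : ℂ) ^ ((a : ℂ) - I * v) * weightKernel α₁ α₂ α₃ a t v := by
    filter_upwards [lt_mem_nhds hy] with x hx
    exact Vweight_eq_one_add_integral (r := 3 * a) ha (by linarith) (by linarith) (by linarith)
      (by linarith) t hx
  have e : B * C * (y / (1 + |t|) ^ 3) ^ a = B * (C * (1 + |t|) ^ (-(3 * a))) * y ^ a := by
    rw [Real.div_rpow hy.le (by positivity), ← Real.rpow_natCast_mul (by positivity),
      Real.rpow_neg (by positivity)]
    push_cast
    ring
  rw [e, hV.iteratedDeriv_eq k]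
  rcases Nat.eq_zero_or_pos k with rfl | hk
  · simpa using key
  · rw [iteratedDeriv_const_add hk, if_neg hk.ne', sub_zero]
    exact key
end

section
/- Define η(1, s) := π^s Γ(s)^{-1} ζ(2s)^{-1} for s ∈ ℂ (where ζ is the Riemann zeta function and Γ the complex Gamma function), and define the Eisenstein spectral weight ω(t) := (4π / cosh(πt)) · | η(1, 1/2 + it) |² for t ∈ ℝ. Then for every ε > 0 there exists a constant C > 0 such that ω(t) ≥ C t^{-ε} for all real t ≥ 2. -/
open Complex Real

/-- The first Fourier coefficient `η(1,s) = π^s Γ(s)⁻¹ ζ(2s)⁻¹` of the Eisenstein series. -/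
noncomputable def etaCoeff (s : ℂ) : ℂ :=
  (Real.pi : ℂ) ^ s * (Complex.Gamma s)⁻¹ * (riemannZeta (2 * s))⁻¹

/-- The modulus of `Γ` on the critical line, from the reflection formula. -/
lemma norm_Gamma_half_add_I_mul_sq (t : ℝ) :
    ‖Complex.Gamma (1 / 2 + Complex.I * t)‖ ^ 2 = π / Real.cosh (π * t) := by
  have hconj : (1 : ℂ) - (1 / 2 + Complex.I * t) = (starRingEnd ℂ) (1 / 2 + Complex.I * t) := by
    apply Complex.ext
    · simp; norm_num
    · simp
  have h := Complex.Gamma_mul_Gamma_one_sub (1 / 2 + Complex.I * t)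
  have hsin : Complex.sin (π * (1 / 2 + Complex.I * t)) = (Real.cosh (π * t) : ℝ) := by
    rw [show (π : ℂ) * (1 / 2 + Complex.I * t) = (π * t : ℂ) * Complex.I + π / 2 by ring,
      Complex.sin_add_pi_div_two, Complex.cos_mul_I]
    push_cast
    rfl
  rw [hconj, Complex.Gamma_conj, Complex.mul_conj, hsin, Complex.normSq_eq_norm_sq] at h
  exact_mod_cast h

lemma spectral_weight_eq (t : ℝ) :
    (4 * π / Real.cosh (π * t)) * ‖etaCoeff (1 / 2 + Complex.I * t)‖ ^ 2 =
      4 * π / ‖riemannZeta (1 + 2 * t * Complex.I)‖ ^ 2 := by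
  have hpi : ‖(π : ℂ) ^ (1 / 2 + Complex.I * t : ℂ)‖ ^ 2 = π := by
    rw [Complex.norm_cpow_eq_rpow_re_of_pos Real.pi_pos, ← Real.rpow_natCast,
      ← Real.rpow_mul Real.pi_pos.le]
    simp
  have hc := Real.cosh_pos (π * t)
  rw [etaCoeff, norm_mul, norm_mul, norm_inv, norm_inv, mul_pow, mul_pow, inv_pow, inv_pow, hpi,
    norm_Gamma_half_add_I_mul_sq,
    show (2 : ℂ) * (1 / 2 + Complex.I * t) = 1 + 2 * t * Complex.I by ring]
  have := Real.pi_pos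
  field_simp

/-- Replacing an integral of `x ↦ x ^ (-s)` over a unit interval by its value at the right endpoint
costs at most `‖s‖ / n ^ 2`. -/
lemma norm_cpow_sub_primitive_le {s : ℂ} (hs : 1 < s.re) {n : ℕ} (hn : 1 ≤ n) :
    ‖((n + 1 : ℝ) : ℂ) ^ (-s) - (((n + 1 : ℝ) : ℂ) ^ (1 - s) / (1 - s)
      - ((n : ℝ) : ℂ) ^ (1 - s) / (1 - s))‖ ≤ ‖s‖ / n ^ 2 := by
  have hn' : (1 : ℝ) ≤ n := by exact_mod_cast hn
  have hs0 : s ≠ 0 := by rintro rfl; norm_num at hs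
  have hs1 : 1 - s ≠ 0 := by
    intro h
    rw [← sub_eq_zero.mp h] at hs
    norm_num at hs
  have hdpow : ∀ x ∈ Set.Icc (n : ℝ) (n + 1),
      HasDerivWithinAt (fun y : ℝ ↦ (y : ℂ) ^ (-s)) (-s * (x : ℂ) ^ (-s - 1))
        (Set.Icc (n : ℝ) (n + 1)) x := fun x hx ↦ by
    have hx0 : x ≠ 0 := by linarith [hx.1]
    exact (hasDerivAt_ofReal_cpow_const hx0 (neg_ne_zero.mpr hs0)).hasDerivWithinAt
  have hpow : ∀ x ∈ Set.Icc (n : ℝ) (n + 1),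
      ‖(x : ℂ) ^ (-s) - ((n + 1 : ℝ) : ℂ) ^ (-s)‖ ≤ ‖s‖ / n ^ 2 := fun x hx ↦ by
    have h := (convex_Icc (n : ℝ) (n + 1)).norm_image_sub_le_of_norm_hasDerivWithin_le
      (C := ‖s‖ / n ^ 2) hdpow (fun y hy ↦ ?_)
      (Set.right_mem_Icc.mpr (by linarith)) hx
    · refine h.trans (mul_le_of_le_one_right (by positivity) ?_)
      rw [Real.norm_eq_abs, abs_le]
      constructor <;> linarith [hx.1, hx.2]
    · have hy0 : 0 < y := by linarith [hy.1]
      rw [norm_mul, norm_neg, Complex.norm_cpow_eq_rpow_re_of_pos hy0, div_eq_mul_inv]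
      gcongr
      calc y ^ (-s - 1).re ≤ y ^ (-2 : ℝ) :=
            Real.rpow_le_rpow_of_exponent_le (by linarith [hy.1]) (by simp; linarith)
        _ = (y ^ 2)⁻¹ := by rw [Real.rpow_neg hy0.le]; norm_num
        _ ≤ ((n : ℝ) ^ 2)⁻¹ := by
            have := hy.1
            gcongr
  have hprim : ∀ x ∈ Set.Icc (n : ℝ) (n + 1),
      HasDerivWithinAt (fun y : ℝ ↦ (y : ℂ) ^ (1 - s) / (1 - s) - y * ((n + 1 : ℝ) : ℂ) ^ (-s))
        ((x : ℂ) ^ (-s) - ((n + 1 : ℝ) : ℂ) ^ (-s)) (Set.Icc (n : ℝ) (n + 1)) x := fun x hx ↦ by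
    have hx0 : x ≠ 0 := by linarith [hx.1]
    have h := hasDerivAt_ofReal_cpow_const' hx0 (r := -s)
      (by intro h; apply hs1; linear_combination h)
    have h3 := (Complex.ofRealCLM.hasDerivAt (x := x)).mul_const (((n + 1 : ℝ) : ℂ) ^ (-s))
    have h2 := (h.fun_sub h3).hasDerivWithinAt (s := Set.Icc (n : ℝ) (n + 1))
    simpa [neg_add_eq_sub] using h2
  have h := (convex_Icc (n : ℝ) (n + 1)).norm_image_sub_le_of_norm_hasDerivWithin_le
    hprim hpow (Set.left_mem_Icc.mpr (by linarith)) (Set.right_mem_Icc.mpr (by linarith))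
  rw [← norm_neg] at h
  convert h using 1
  · congr 1
    push_cast
    ring
  · simp

lemma norm_natCast_cpow_one_sub_div_le {s : ℂ} (hs : 1 < s.re) {n : ℕ} (hn : 1 ≤ n) :
    ‖((n : ℝ) : ℂ) ^ (1 - s) / (1 - s)‖ ≤ 1 / ‖s - 1‖ := by
  have hn' : (1 : ℝ) ≤ n := by exact_mod_cast hn
  rw [norm_div, Complex.norm_cpow_eq_rpow_re_of_pos (by linarith), norm_sub_rev 1 s]
  gcongr
  exact Real.rpow_le_one_of_one_le_of_nonpos hn' (by simp; linarith)

lemma norm_sum_cpow_sub_primitive_le {s : ℂ} (hs : 1 < s.re) {N : ℕ} (hN : 2 ≤ N) (M : ℕ) :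
    ‖∑ k ∈ Finset.range M, ((((N + k : ℕ) : ℝ) + 1 : ℝ) : ℂ) ^ (-s)
      - ((((N + M : ℕ) : ℝ) : ℂ) ^ (1 - s) / (1 - s) - ((N : ℝ) : ℂ) ^ (1 - s) / (1 - s))‖
      ≤ ‖s‖ * (1 / (N - 1) - 1 / (N + M - 1)) := by
  have hN' : (2 : ℝ) ≤ N := by exact_mod_cast hN
  induction M with
  | zero => simp
  | succ M ih =>
    have h := norm_cpow_sub_primitive_le hs (n := N + M) (by omega)
    have hstep : ‖s‖ / ((N + M : ℕ) : ℝ) ^ 2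
        ≤ ‖s‖ * (1 / (N + M - 1) - 1 / (N + (M + 1 : ℕ) - 1)) := by
      rw [div_eq_mul_one_div]
      gcongr
      have hM : (0 : ℝ) ≤ M := M.cast_nonneg
      push_cast
      rw [div_sub_div _ _ (by linarith) (by linarith), div_le_div_iff₀ (by positivity)
        (mul_pos (by linarith) (by linarith))]
      nlinarith
    rw [Finset.sum_range_succ]
    refine le_trans (le_of_eq ?_) ((norm_add_le_of_le ih (h.trans hstep)).trans (le_of_eq ?_))
    · congr 1
      push_cast
      ring_nf
    · ring

lemma norm_sum_natCast_cpow_le_harmonic {s : ℂ} (hs : 1 < s.re) (N : ℕ) :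
    ‖∑ k ∈ Finset.range N, (((k : ℝ) + 1 : ℝ) : ℂ) ^ (-s)‖ ≤ (harmonic N : ℝ) := by
  rw [harmonic]
  push_cast
  refine norm_sum_le_of_le _ fun k _ ↦ ?_
  have hk : (0 : ℝ) ≤ k := k.cast_nonneg
  rw [← Complex.ofReal_natCast, ← Complex.ofReal_one, ← Complex.ofReal_add,
    Complex.norm_cpow_eq_rpow_re_of_pos (by linarith), ← Real.rpow_neg_one]
  exact Real.rpow_le_rpow_of_exponent_le (by linarith) (by simp; linarith)

lemma norm_riemannZeta_le_of_one_lt_re {s : ℂ} (hs : 1 < s.re) {N : ℕ} (hN : 2 ≤ N) :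
    ‖riemannZeta s‖ ≤ harmonic N + 2 / ‖s - 1‖ + ‖s‖ / (N - 1) := by
  have hN' : (2 : ℝ) ≤ N := by exact_mod_cast hN
  have hsum : HasSum (fun k : ℕ ↦ (((k : ℝ) + 1 : ℝ) : ℂ) ^ (-s)) (riemannZeta s) := by
    rw [zeta_eq_tsum_one_div_nat_add_one_cpow hs]
    have h := ((Complex.summable_one_div_nat_cpow.mpr hs).comp_injective
      (add_left_injective 1)).hasSum
    simpa [Function.comp_def, Complex.cpow_neg] using h
  have hlim := (hsum.tendsto_sum_nat.comp (Filter.tendsto_add_atTop_nat N)).norm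
  refine le_of_tendsto' hlim fun M ↦ ?_
  have h₁ := norm_sum_natCast_cpow_le_harmonic hs N
  have h₂ := norm_sum_cpow_sub_primitive_le hs hN M
  have h₃ := norm_natCast_cpow_one_sub_div_le hs (n := N) (by omega)
  have h₄ := norm_natCast_cpow_one_sub_div_le hs (n := N + M) (by omega)
  have h₅ : ‖s‖ * (1 / (N - 1) - 1 / (N + M - 1)) ≤ ‖s‖ / (N - 1) := by
    have : (0 : ℝ) ≤ 1 / (N + M - 1) := by
      have hM : (0 : ℝ) ≤ M := M.cast_nonneg
      exact div_nonneg zero_le_one (by linarith)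
    rw [div_eq_mul_one_div ‖s‖]
    gcongr
    linarith
  simp only [Function.comp_apply]
  rw [add_comm M N, Finset.sum_range_add]
  have h := norm_add_le_of_le h₁ (norm_add_le_of_le (h₂.trans h₅) (norm_sub_le_of_le h₄ h₃))
  rw [sub_add_cancel] at h
  refine h.trans (le_of_eq ?_)
  ring

lemma norm_riemannZeta_le_of_one_le_re {s : ℂ} (hs : 1 ≤ s.re) (hs1 : s ≠ 1) {N : ℕ}
    (hN : 2 ≤ N) : ‖riemannZeta s‖ ≤ harmonic N + 2 / ‖s - 1‖ + ‖s‖ / (N - 1) := by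
  have hlim : Filter.Tendsto (fun x : ℝ ↦ s + x) (nhdsWithin 0 (Set.Ioi 0)) (nhds s) := by
    have : Continuous fun x : ℝ ↦ s + x := by fun_prop
    simpa using (this.tendsto 0).mono_left nhdsWithin_le_nhds
  have hζ := ((differentiableAt_riemannZeta hs1).continuousAt.tendsto.comp hlim).norm
  have hb : ContinuousAt (fun z : ℂ ↦ (harmonic N : ℝ) + 2 / ‖z - 1‖ + ‖z‖ / (N - 1)) s := by
    have : ‖s - 1‖ ≠ 0 := norm_ne_zero_iff.mpr (sub_ne_zero.mpr hs1)
    fun_prop (disch := assumption)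
  refine le_of_tendsto_of_tendsto hζ (hb.tendsto.comp hlim) ?_
  filter_upwards [self_mem_nhdsWithin] with x hx
  have hx' : 0 < x := hx
  exact norm_riemannZeta_le_of_one_lt_re (by simp; linarith) hN

/-- The bound `ζ(1 + 2it) ≪ t ^ δ` for every `δ > 0`. -/
lemma norm_riemannZeta_one_add_le {δ : ℝ} (hδ : 0 < δ) {t : ℝ} (ht : 2 ≤ t) :
    ‖riemannZeta (1 + 2 * t * Complex.I)‖ ≤ (4 + 1 / δ) * (3 * t) ^ δ := by
  set s : ℂ := 1 + 2 * t * Complex.I with hs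
  have hs1 : ‖s - 1‖ = 2 * t := by
    rw [hs, add_sub_cancel_left]
    simp [abs_of_nonneg (by linarith : 0 ≤ t)]
  have hsn : ‖s‖ ≤ 1 + 2 * t := by
    have := norm_add_le (s - 1) 1
    rw [sub_add_cancel, hs1, norm_one] at this
    linarith
  have hne : s ≠ 1 := by
    intro h
    rw [h, sub_self, norm_zero] at hs1
    linarith
  have hceil := Nat.le_ceil (2 * t)
  have hceil' := Nat.ceil_lt_add_one (by linarith : 0 ≤ 2 * t)
  have hN : 2 ≤ ⌈2 * t⌉₊ + 1 := by
    have : (1 : ℝ) ≤ (⌈2 * t⌉₊ : ℝ) := by linarith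
    have : 1 ≤ ⌈2 * t⌉₊ := by exact_mod_cast this
    omega
  have h := norm_riemannZeta_le_of_one_le_re (s := s) (by simp [hs]) hne hN
  have hharm := harmonic_le_one_add_log (⌈2 * t⌉₊ + 1)
  have hlog : Real.log ((⌈2 * t⌉₊ + 1 : ℕ) : ℝ) ≤ Real.log (3 * t) := by
    apply Real.log_le_log
    · positivity
    · push_cast
      linarith
  have hlog' := Real.log_le_rpow_div (by linarith : 0 ≤ 3 * t) hδ
  have hone : 1 ≤ (3 * t) ^ δ := Real.one_le_rpow (by linarith) hδ.le
  have hpole : 2 / ‖s - 1‖ ≤ 1 / 2 := by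
    rw [hs1, div_le_div_iff₀ (by linarith) (by norm_num)]
    linarith
  have herr : ‖s‖ / ((⌈2 * t⌉₊ + 1 : ℕ) - 1 : ℝ) ≤ 5 / 4 := by
    push_cast
    rw [add_sub_cancel_right, div_le_iff₀ (by linarith)]
    linarith
  calc ‖riemannZeta s‖ ≤ 4 + (3 * t) ^ δ / δ := by linarith
    _ ≤ 4 * (3 * t) ^ δ + (3 * t) ^ δ / δ := by linarith
    _ = (4 + 1 / δ) * (3 * t) ^ δ := by ring

/-- The Eisenstein spectral weight `ω(t) = (4π/cosh(πt)) |η(1, 1/2+it)|²`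
satisfies `ω(t) ≫_ε t^{-ε}`. -/
theorem eisenstein_spectral_weight_lower_bound :
    ∀ ε : ℝ, 0 < ε → ∃ C : ℝ, 0 < C ∧ ∀ t : ℝ, 2 ≤ t →
      C * t ^ (-ε) ≤
        (4 * π / Real.cosh (π * t)) * ‖etaCoeff (1 / 2 + Complex.I * t)‖ ^ 2 := by
  intro ε hε
  have hpi := Real.pi_pos
  refine ⟨4 * π / ((4 + 1 / (ε / 2)) ^ 2 * 3 ^ ε), by positivity, fun t ht ↦ ?_⟩
  have ht0 : 0 < t := by linarith
  have hζ : 0 < ‖riemannZeta (1 + 2 * t * Complex.I)‖ :=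
    norm_pos_iff.mpr (riemannZeta_ne_zero_of_one_le_re (by simp))
  have hbound : ‖riemannZeta (1 + 2 * t * Complex.I)‖ ^ 2
      ≤ (4 + 1 / (ε / 2)) ^ 2 * 3 ^ ε * t ^ ε := by
    calc ‖riemannZeta (1 + 2 * t * Complex.I)‖ ^ 2
        ≤ ((4 + 1 / (ε / 2)) * (3 * t) ^ (ε / 2)) ^ 2 := by
          gcongr
          exact norm_riemannZeta_one_add_le (half_pos hε) ht
      _ = (4 + 1 / (ε / 2)) ^ 2 * 3 ^ ε * t ^ ε := by
          rw [mul_pow, ← Real.rpow_natCast ((3 * t) ^ (ε / 2)), ← Real.rpow_mul (by positivity),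
            Nat.cast_ofNat, div_mul_cancel₀ ε two_ne_zero, Real.mul_rpow (by norm_num) ht0.le,
            mul_assoc]
  rw [spectral_weight_eq, Real.rpow_neg ht0.le, ← div_eq_mul_inv, div_div]
  gcongr
end
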